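/- Let r^(0), …, r^(l−1) ∈ ℝ^N be nonzero, set β^(j) = ‖r^(j)‖₂²/‖r^(j−1)‖₂², and let L̃^(l) be the l×l lower bidiagonal matrix with ones on the diagonal and −√(β^(1)), …, −√(β^(l−1)) on the subdiagonal. Let ρ = max_{0 ≤ j ≤ i ≤ l−1} ‖r^(i)‖₂²/‖r^(j)‖₂². Then the Frobenius norm of the inverse satisfies ‖(L̃^(l))^{−1}‖_F² ≤ l + l(l−1)ρ/2 ≤ l(1 + lρ/2). -/

import Mathlib

open Matrix

/-- The Euclidean (ℓ²) norm of a vector in `ℝ^N`. -/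
noncomputable def euclNorm {N : ℕ} (x : Fin N → ℝ) : ℝ := Real.sqrt (∑ i, x i ^ 2)

lemma euclNorm_nonneg {N : ℕ} (x : Fin N → ℝ) : 0 ≤ euclNorm x := Real.sqrt_nonneg _

lemma euclNorm_pos {N : ℕ} {x : Fin N → ℝ} (hx : x ≠ 0) : 0 < euclNorm x := by
  obtain ⟨i, hi⟩ := Function.ne_iff.mp hx
  exact Real.sqrt_pos.mpr (Finset.sum_pos' (fun _ _ => sq_nonneg _)
    ⟨i, Finset.mem_univ i, by have : x i ≠ 0 := hi; positivity⟩)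

/-- The inverse of a unit lower bidiagonal matrix whose subdiagonal entries are the negatives of
the consecutive ratios of a nonvanishing sequence. -/
lemma inv_bidiagonal_ratio {l : ℕ} (a s : ℕ → ℝ) (ha : ∀ j < l, a j ≠ 0)
    (hs : ∀ j, j + 1 < l → s (j + 1) = a (j + 1) / a j) :
    (Matrix.of fun (i j : Fin l) =>
      if (i : ℕ) = (j : ℕ) then 1 else if (i : ℕ) = (j : ℕ) + 1 then -s i else 0)⁻¹ =
    Matrix.of fun (i j : Fin l) => if j ≤ i then a i / a j else 0 := by
  refine Matrix.inv_eq_right_inv ?_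
  ext ⟨i, hi⟩ j
  have split : ∀ k : Fin l,
      (if i = (k : ℕ) then (1 : ℝ) else if i = (k : ℕ) + 1 then -s i else 0) =
      (if (⟨i, hi⟩ : Fin l) = k then 1 else 0) + (if i = (k : ℕ) + 1 then -s i else 0) := by
    intro k
    simp only [Fin.ext_iff]
    split_ifs <;> first | omega | simp
  simp only [Matrix.mul_apply, Matrix.of_apply, split, add_mul, Finset.sum_add_distrib, ite_mul,
    one_mul, zero_mul, Finset.sum_ite_eq, Finset.mem_univ, if_true, Matrix.one_apply]
  have hj := ha j j.2
  cases i with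
  | zero =>
    have idx : ∀ k : Fin l, (0 = (k : ℕ) + 1) = False := fun k => by simp
    simp only [idx, if_false, Finset.sum_const_zero, add_zero, Fin.le_def, Fin.ext_iff,
      Nat.le_zero, eq_comm (a := 0)]
    split_ifs with h
    · rw [h] at hj ⊢
      exact div_self hj
    · rfl
  | succ m =>
    have hm : m < l := by omega
    have idx : ∀ k : Fin l, (m + 1 = (k : ℕ) + 1) = ((⟨m, hm⟩ : Fin l) = k) := by
      intro k
      simp [Fin.ext_iff]
    simp only [idx, Finset.sum_ite_eq, Finset.mem_univ, if_true, hs m hi]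
    simp only [Fin.le_def, Fin.ext_iff]
    have ham := ha m hm
    rcases lt_trichotomy (j : ℕ) (m + 1) with h | h | h
    · rw [if_pos (by omega), if_pos (by omega), if_neg (by omega)]
      field_simp
      ring
    · rw [if_pos (by omega), if_neg (by omega), if_pos (by omega), ← h]
      simp [hj]
    · rw [if_neg (by omega), if_neg (by omega), if_neg (by omega)]
      simp

lemma sum_unit_lower_triangular (l : ℕ) (c : ℝ) :
    ∑ i : Fin l, ∑ j : Fin l, ((if i = j then 1 else 0) + (if j < i then c else 0)) =
      (l : ℝ) + (l : ℝ) * ((l : ℝ) - 1) * c / 2 := by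
  have row : ∀ i : Fin l, ∑ j : Fin l, ((if i = j then 1 else 0) + (if j < i then c else 0)) =
      1 + (i : ℕ) * c := by
    intro i
    rw [Finset.sum_add_distrib, Finset.sum_ite_eq, if_pos (Finset.mem_univ i),
      ← Finset.sum_filter, Finset.sum_const, Finset.filter_gt_eq_Iio, Fin.card_Iio, nsmul_eq_mul]
  simp only [row]
  rw [Fin.sum_univ_eq_sum_range (fun i => 1 + (i : ℝ) * c) l]
  clear row
  induction l with
  | zero => simp
  | succ n ih =>
    rw [Finset.sum_range_succ, ih]
    push_cast
    ring

/-- **Frobenius norm bound for the inverse bidiagonal factor.** With the Fletcher–Reeves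
coefficients `β^(j) = ‖r^(j)‖²/‖r^(j−1)‖²` and
`ρ = max_{0 ≤ j ≤ i ≤ l−1} ‖r^(i)‖²/‖r^(j)‖²`, the lower bidiagonal matrix `L̃^(l)` with
ones on the diagonal and `−√β^(1), …, −√β^(l−1)` on the subdiagonal satisfies
`‖(L̃^(l))⁻¹‖_F² ≤ l + l(l−1)ρ/2 ≤ l(1 + lρ/2)`. -/
theorem bidiagonal_inverse_frobenius_bound
    (N l : ℕ) (hl : 1 ≤ l)
    (r : ℕ → Fin N → ℝ) (hrne : ∀ j < l, r j ≠ 0)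
    (β : ℕ → ℝ)
    (hβ : ∀ j, 1 ≤ j → β j = (euclNorm (r j)) ^ 2 / (euclNorm (r (j - 1))) ^ 2)
    (Lt : Matrix (Fin l) (Fin l) ℝ)
    (hLt : Lt = Matrix.of fun (i j : Fin l) =>
      if (i : ℕ) = (j : ℕ) then 1
      else if (i : ℕ) = (j : ℕ) + 1 then -Real.sqrt (β i) else 0)
    (ρ : ℝ)
    (hρ : ρ = ⨆ i : Fin l, ⨆ j : Fin l, ⨆ _ : (j : ℕ) ≤ (i : ℕ),
      (euclNorm (r i)) ^ 2 / (euclNorm (r j)) ^ 2) :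
    (∑ i, ∑ j, (Lt⁻¹ i j) ^ 2) ≤ (l : ℝ) + (l : ℝ) * ((l : ℝ) - 1) * ρ / 2 ∧
    (l : ℝ) + (l : ℝ) * ((l : ℝ) - 1) * ρ / 2 ≤ (l : ℝ) * (1 + (l : ℝ) * ρ / 2) := by
  have hpos : ∀ j < l, 0 < euclNorm (r j) := fun j hj => euclNorm_pos (hrne j hj)
  have hle : ∀ i j : Fin l, j ≤ i → euclNorm (r i) ^ 2 / euclNorm (r j) ^ 2 ≤ ρ := by
    intro i j hij
    rw [hρ]
    refine le_ciSup_of_le (Set.finite_range _).bddAbove i ?_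
    refine le_ciSup_of_le (Set.finite_range _).bddAbove j ?_
    exact le_ciSup_of_le (Set.finite_range _).bddAbove hij le_rfl
  have hρ0 : 0 ≤ ρ := le_trans (by positivity) (hle ⟨0, hl⟩ ⟨0, hl⟩ le_rfl)
  have hsqrt : ∀ j, j + 1 < l → √(β (j + 1)) = euclNorm (r (j + 1)) / euclNorm (r j) := by
    intro j _
    rw [hβ (j + 1) (by omega), Nat.add_sub_cancel, ← div_pow]
    exact Real.sqrt_sq (div_nonneg (euclNorm_nonneg _) (euclNorm_nonneg _))
  constructor
  · rw [hLt, inv_bidiagonal_ratio (fun j => euclNorm (r j)) (fun j => √(β j))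
      (fun j hj => (hpos j hj).ne') hsqrt, ← sum_unit_lower_triangular]
    refine Finset.sum_le_sum fun i _ => Finset.sum_le_sum fun j _ => ?_
    rw [Matrix.of_apply]
    rcases lt_trichotomy j i with h | rfl | h
    · simpa [h.le, h, h.ne', div_pow] using hle i j h.le
    · simp [(hpos j j.2).ne']
    · simp [h.not_ge, h.not_gt, h.ne]
  · have : 0 ≤ (l : ℝ) * ρ := by positivity
    linarith
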